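/- Let n be odd and let P(x) = Δ^{(n−1)/2} x^{n−1}, where x = x₀ + x₁e₁ + ... + xₙeₙ is a paravector variable in ℝ^{n+1}, Δ = ∑_{i=0}^{n} ∂²/∂xᵢ² is the Laplacian, and x^{n−1} is the (n−1)-st power in the Clifford algebra ℝₙ. Then P is identically equal to the constant γₙ = (−1)^{(n−1)/2} 2^{n−1} (((n−1)/2)!)². -/

import Mathlib

/-- The second partial derivative of `g : ℝ^k → A` in the `i`-th coordinate at `x`. -/
noncomputable def secondPartial {A : Type*} [NormedAddCommGroup A] [NormedSpace ℝ A]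
    {k : ℕ} (g : (Fin k → ℝ) → A) (i : Fin k) (x : Fin k → ℝ) : A :=
  deriv (fun t : ℝ => deriv (fun u : ℝ => g (Function.update x i u)) t) (x i)

/-- The Laplacian `Δ g = ∑ᵢ ∂²g/∂xᵢ²` of `g : ℝ^k → A`. -/
noncomputable def Lap {A : Type*} [NormedAddCommGroup A] [NormedSpace ℝ A]
    {k : ℕ} (g : (Fin k → ℝ) → A) : (Fin k → ℝ) → A :=
  fun x => ∑ i, secondPartial g i x

/-- The constant `γₙ = (-1)^((n-1)/2) 2^(n-1) (((n-1)/2)!)²`. -/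
noncomputable def gammaN (n : ℕ) : ℝ :=
  (-1) ^ ((n - 1) / 2) * 2 ^ (n - 1) * ((((n - 1) / 2).factorial : ℝ)) ^ 2

section helpers

variable {A : Type*} [NormedRing A] [NormedAlgebra ℝ A]

/-- `g` has second partial derivative `y` in coordinate `i` at `x`. -/
def HasSP {k : ℕ} (g : (Fin k → ℝ) → A) (i : Fin k) (x : Fin k → ℝ) (y : A) : Prop :=
  ∃ g' : ℝ → A, (∀ u, HasDerivAt (fun u : ℝ => g (Function.update x i u)) (g' u) u) ∧
    HasDerivAt g' y (x i)

lemma HasSP.eq {k : ℕ} {g : (Fin k → ℝ) → A} {i : Fin k} {x : Fin k → ℝ} {y : A}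
    (h : HasSP g i x y) : secondPartial g i x = y := by
  obtain ⟨g', h1, h2⟩ := h
  unfold secondPartial
  have : (fun t : ℝ => deriv (fun u : ℝ => g (Function.update x i u)) t) = g' :=
    funext fun t => (h1 t).deriv
  rw [this]
  exact h2.deriv

/-- `g` has Laplacian `y` at `x`. -/
def HasLap {k : ℕ} (g : (Fin k → ℝ) → A) (x : Fin k → ℝ) (y : A) : Prop :=
  ∃ s : Fin k → A, (∀ i, HasSP g i x (s i)) ∧ ∑ i, s i = y

lemma HasLap.eq {k : ℕ} {g : (Fin k → ℝ) → A} {x : Fin k → ℝ} {y : A}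
    (h : HasLap g x y) : Lap g x = y := by
  obtain ⟨s, h1, h2⟩ := h
  unfold Lap
  rw [← h2]
  exact Finset.sum_congr rfl fun i _ => (h1 i).eq

lemma HasLap.sum {k : ℕ} {ι : Type*} (t : Finset ι) {g : ι → (Fin k → ℝ) → A} {x : Fin k → ℝ}
    {y : ι → A} (a : ι → ℝ) (h : ∀ j ∈ t, HasLap (g j) x (y j)) :
    HasLap (fun c => ∑ j ∈ t, a j • g j c) x (∑ j ∈ t, a j • y j) := by
  have h' : ∀ j, ∃ s : Fin k → A, j ∈ t → (∀ i, HasSP (g j) i x (s i)) ∧ ∑ i, s i = y j := by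
    intro j
    by_cases hj : j ∈ t
    · obtain ⟨s, hs⟩ := h j hj
      exact ⟨s, fun _ => hs⟩
    · exact ⟨0, fun q => absurd q hj⟩
  choose s hs using h'
  refine ⟨fun i => ∑ j ∈ t, a j • s j i, fun i => ?_, ?_⟩
  · have h2 : ∀ j, ∃ g' : ℝ → A, j ∈ t →
        (∀ u, HasDerivAt (fun u : ℝ => g j (Function.update x i u)) (g' u) u) ∧
        HasDerivAt g' (s j i) (x i) := by
      intro j
      by_cases hj : j ∈ t
      · obtain ⟨s, hs⟩ := (hs j hj).1 i
        exact ⟨s, fun _ => hs⟩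
      · exact ⟨0, fun q => absurd q hj⟩
    choose g' hg' using h2
    refine ⟨fun u => ∑ j ∈ t, a j • g' j u, fun u => ?_, ?_⟩
    · exact HasDerivAt.fun_sum fun j hj => ((hg' j hj).1 u).const_smul (a j)
    · exact HasDerivAt.fun_sum fun j hj => ((hg' j hj).2).const_smul (a j)
  · rw [Finset.sum_comm]
    refine Finset.sum_congr rfl fun j hj => ?_
    rw [← Finset.smul_sum, (hs j hj).2]

/-- minus the squared norm of the vector part -/
def QQ {n : ℕ} (c : Fin (n + 1) → ℝ) : ℝ := -∑ i : Fin n, c i.succ ^ 2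

lemma QQ_update_zero {n : ℕ} (c : Fin (n + 1) → ℝ) (u : ℝ) :
    QQ (Function.update c 0 u) = QQ c := by
  unfold QQ
  simp [Function.update_apply]

lemma QQ_update_succ {n : ℕ} (c : Fin (n + 1) → ℝ) (i : Fin n) (u : ℝ) :
    QQ (Function.update c i.succ u) = QQ c + c i.succ ^ 2 - u ^ 2 := by
  unfold QQ
  have h : ∀ j : Fin n, (Function.update c i.succ u j.succ) ^ 2
      = c j.succ ^ 2 + if j = i then u ^ 2 - c i.succ ^ 2 else 0 := by
    intro j
    by_cases hj : j = i
    · subst hj; simp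
    · have : j.succ ≠ i.succ := fun h => hj (Fin.succ_injective _ h)
      simp [hj]
  simp only [h, Finset.sum_add_distrib, Finset.sum_ite_eq', Finset.mem_univ, if_true]
  ring

lemma hasLap_aux {n : ℕ} (p j : ℕ) (L : (Fin (n + 1) → ℝ) → A) (l : Fin n → A) (ε : ℝ)
    (hL0 : ∀ x u, L (Function.update x 0 u) = L x)
    (hL : ∀ x i u, L (Function.update x (Fin.succ i) u) = L x + (u - x i.succ) • l i)
    (x : Fin (n + 1) → ℝ)
    (hE : ∑ i : Fin n, x i.succ • l i = ε • L x) :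
    HasLap (fun c => (c 0 ^ p * QQ c ^ j) • L c) x
      ((p * (p - 1) * x 0 ^ (p - 2) * QQ x ^ j) • L x
        + (x 0 ^ p * (-2 * j * (n + 2 * j - 2 + 2 * ε)) * QQ x ^ (j - 1)) • L x) := by
  refine ⟨Fin.cons ((p * (p - 1) * x 0 ^ (p - 2) * QQ x ^ j) • L x) (fun i =>
    (x 0 ^ p * (j * (j - 1) * QQ x ^ (j - 2) * (4 * x i.succ ^ 2) - 2 * j * QQ x ^ (j - 1))) • L x
     + (x 0 ^ p * (-4 * j * QQ x ^ (j - 1))) • (x i.succ • l i)), fun i => ?_, ?_⟩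
  · refine Fin.cases ?_ (fun i => ?_) i
    · refine ⟨fun u => (p * u ^ (p - 1) * QQ x ^ j) • L x, fun u => ?_, ?_⟩
      · simp only [Function.update_self, hL0, QQ_update_zero]
        exact ((hasDerivAt_pow p u).mul_const _).smul_const _
      · simp only [Fin.cons_zero]
        have := ((((hasDerivAt_pow (p-1) (x 0)).const_mul (p:ℝ)).mul_const (QQ x ^ j)).smul_const
          (L x))
        refine this.congr_deriv ?_
        congr 1
        rcases p with _ | p
        · simp
        · have : p + 1 - 2 = p - 1 := by omega
          rw [this]
          simp only [Nat.add_sub_cancel, Nat.cast_add, Nat.cast_one, add_sub_cancel_right]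
          ring
    · have hQ : ∀ u : ℝ, HasDerivAt (fun u : ℝ => QQ x + x i.succ ^ 2 - u ^ 2) (-2 * u) u := by
        intro u
        have := (hasDerivAt_pow 2 u).const_sub (QQ x + x i.succ ^ 2)
        refine this.congr_deriv ?_
        simp
      have hl : ∀ u : ℝ, HasDerivAt (fun u : ℝ => L x + (u - x i.succ) • l i) (l i) u := by
        intro u
        have := (((hasDerivAt_id u).sub_const (x i.succ)).smul_const (l i)).const_add (L x)
        simpa using this
      refine ⟨fun u => (x 0 ^ p * (QQ x + x i.succ ^ 2 - u ^ 2) ^ j) • l i +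
        (x 0 ^ p * (j * (QQ x + x i.succ ^ 2 - u ^ 2) ^ (j - 1) * (-2 * u))) •
          (L x + (u - x i.succ) • l i), fun u => ?_, ?_⟩
      · have h0 : ∀ u, Function.update x i.succ u 0 = x 0 := fun u => by
          simp [Function.update_apply, (Fin.succ_ne_zero i).symm]
        simp only [h0, hL, QQ_update_succ]
        exact (((hQ u).fun_pow j).const_mul (x 0 ^ p)).fun_smul (hl u)
      · simp only [Fin.cons_succ]
        have a1 := ((((hQ (x i.succ)).fun_pow j).const_mul (x 0 ^ p)).smul_const (l i))
        have a2 := ((((((hQ (x i.succ)).fun_pow (j-1)).const_mul (j:ℝ)).fun_mul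
          ((hasDerivAt_id' (x i.succ)).const_mul (-2:ℝ))).const_mul (x 0 ^ p)).fun_smul
            (hl (x i.succ)))
        refine (a1.fun_add a2).congr_deriv ?_
        simp only [add_sub_cancel_right, sub_self, zero_smul, add_zero]
        rcases j with _ | j
        · simp
        · simp only [Nat.add_sub_cancel, Nat.cast_add, Nat.cast_one, add_sub_cancel_right]
          have : j + 1 - 2 = j - 1 := by omega
          rw [this]
          module
  · rw [Fin.sum_univ_succ]
    simp only [Fin.cons_zero, Fin.cons_succ]
    congr 1
    rw [Finset.sum_add_distrib, ← Finset.smul_sum, hE, ← Finset.sum_smul, ← Finset.mul_sum,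
      Finset.sum_sub_distrib, ← Finset.mul_sum, ← Finset.mul_sum]
    have hs : ∑ i : Fin n, x i.succ ^ 2 = - QQ x := by simp [QQ]
    rw [hs, smul_smul, ← add_smul]
    congr 1
    simp only [Finset.sum_const, Finset.card_univ, Fintype.card_fin, nsmul_eq_mul]
    rcases j with _ | _ | j
    · simp
    · simp; ring
    · simp only [Nat.add_sub_cancel, show j + 1 + 1 - 1 = j + 1 from rfl,
        show j + 1 + 1 - 2 = j from rfl]
      push_cast
      ring

/-- the vector part -/
def VV {n : ℕ} (e : Fin n → A) (c : Fin (n + 1) → ℝ) : A := ∑ i : Fin n, c i.succ • e i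

lemma VV_update_zero {n : ℕ} (e : Fin n → A) (c : Fin (n + 1) → ℝ) (u : ℝ) :
    VV e (Function.update c 0 u) = VV e c := by
  unfold VV
  simp [Function.update_apply]

lemma VV_update_succ {n : ℕ} (e : Fin n → A) (c : Fin (n + 1) → ℝ) (i : Fin n) (u : ℝ) :
    VV e (Function.update c i.succ u) = VV e c + (u - c i.succ) • e i := by
  unfold VV
  have h : ∀ j : Fin n, (Function.update c i.succ u j.succ) • e j
      = c j.succ • e j + if j = i then (u - c i.succ) • e i else 0 := by
    intro j
    by_cases hj : j = i
    · subst hj; simp [← add_smul]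
    · have : j.succ ≠ i.succ := fun h => hj (Fin.succ_injective _ h)
      simp [hj]
  simp only [h, Finset.sum_add_distrib, Finset.sum_ite_eq', Finset.mem_univ, if_true]

lemma VV_sq {n : ℕ} (e : Fin n → A)
    (he : ∀ i j, e i * e j + e j * e i = algebraMap ℝ A (if i = j then -2 else 0))
    (c : Fin (n + 1) → ℝ) : VV e c ^ 2 = QQ c • (1 : A) := by
  have h1 : VV e c ^ 2 = ∑ i : Fin n, ∑ j : Fin n, (c i.succ * c j.succ) • (e i * e j) := by
    simp only [VV, sq, Finset.sum_mul_sum, smul_mul_smul_comm]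
  have h2 : VV e c ^ 2 = ∑ i : Fin n, ∑ j : Fin n, (c i.succ * c j.succ) • (e j * e i) := by
    rw [h1, Finset.sum_comm]
    simp only [mul_comm]
  have h3 : (2 : ℝ) • VV e c ^ 2 = (2 : ℝ) • (QQ c • (1 : A)) := by
    rw [two_smul]
    nth_rewrite 1 [h1]
    rw [h2]
    simp only [← Finset.sum_add_distrib, ← smul_add, he]
    simp only [Algebra.algebraMap_eq_smul_one, smul_smul, ← Finset.sum_smul]
    congr 1
    simp only [mul_ite, mul_zero, Finset.sum_ite_eq, Finset.mem_univ, if_true, QQ]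
    rw [mul_neg, Finset.mul_sum, ← Finset.sum_neg_distrib]
    exact Finset.sum_congr rfl fun i _ => by ring
  exact smul_right_injective A (two_ne_zero : (2 : ℝ) ≠ 0) h3

/-- Laplacian coefficient of a power of the vector part. -/
noncomputable def kap (n q : ℕ) : ℝ :=
  if Even q then -(q * (q + n - 2) : ℝ) else -((q - 1) * (q + n - 1) : ℝ)

lemma hasLap_mono {n : ℕ} (e : Fin n → A)
    (he : ∀ i j, e i * e j + e j * e i = algebraMap ℝ A (if i = j then -2 else 0))
    (p q : ℕ) (x : Fin (n + 1) → ℝ) :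
    HasLap (fun c => c 0 ^ p • VV e c ^ q) x
      ((p * (p - 1) * x 0 ^ (p - 2)) • VV e x ^ q
        + (kap n q * x 0 ^ p) • VV e x ^ (q - 2)) := by
  have hev : ∀ c j, VV e c ^ (2 * j) = QQ c ^ j • (1 : A) := by
    intro c j
    rw [pow_mul, VV_sq e he, smul_pow, one_pow]
  have hod : ∀ c j, VV e c ^ (2 * j + 1) = QQ c ^ j • VV e c := by
    intro c j
    rw [pow_succ, hev, smul_one_mul]
  rcases Nat.even_or_odd' q with ⟨j, rfl | rfl⟩
  · have := hasLap_aux (A := A) (n := n) p j (fun _ => 1) (fun _ => 0) 0 (by simp) (by simp) x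
      (by simp)
    simp only [hev, smul_smul]
    have h2 : 2 * j - 2 = 2 * (j - 1) := by omega
    rw [h2, hev, smul_smul]
    convert this using 3
    simp only [kap, even_two, Even.mul_right, if_true]
    push_cast
    ring
  · have := hasLap_aux (A := A) (n := n) p j (VV e) e 1 (VV_update_zero e) (VV_update_succ e) x
      (by simp [VV])
    simp only [hod, smul_smul]
    convert this using 2
    rcases j with _ | j
    · simp [kap]
    · have h2 : 2 * (j + 1) + 1 - 2 = 2 * j + 1 := by omega
      have h3 : ¬ Even (2 * (j + 1) + 1) := by simp [parity_simps]
      rw [h2, hod, smul_smul]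
      congr 1
      simp only [kap, h3, if_false, Nat.add_sub_cancel]
      push_cast
      ring

/-- homogeneous polynomial with prescribed normalized coefficients -/
noncomputable def FF {n : ℕ} (e : Fin n → A) (d : ℕ) (b : ℕ → ℝ) (c : Fin (n + 1) → ℝ) : A :=
  ∑ k ∈ Finset.range (d + 1), (b k / ((d - k).factorial * k.factorial)) •
    (c 0 ^ (d - k) • VV e c ^ k)

/-- index shift -/
noncomputable def sg (k : ℕ) : ℝ := if Even k then k + 1 else k + 2

/-- coefficient operator -/
noncomputable def TT (n : ℕ) (b : ℕ → ℝ) (k : ℕ) : ℝ :=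
  b k - (sg k + n - 1) / sg k * b (k + 2)

lemma sg_pos (k : ℕ) : 0 < sg k := by
  unfold sg; split_ifs <;> positivity

lemma sg_add (k : ℕ) : sg (k + 2) = sg k + 2 := by
  unfold sg
  simp only [Nat.even_add, even_two, iff_true]
  split_ifs <;> push_cast <;> ring

lemma kap_sg (n k : ℕ) : kap n (k + 2) = - ((k + 1) * (k + 2)) * ((sg k + n - 1) / sg k) := by
  unfold kap sg
  simp only [Nat.even_add, even_two, iff_true]
  have h1 : (k + 1 : ℝ) ≠ 0 := by positivity
  have h2 : (k + 2 : ℝ) ≠ 0 := by positivity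
  split_ifs
  · push_cast; field_simp; ring
  · push_cast; field_simp; ring

lemma Lap_FF {n : ℕ} (e : Fin n → A)
    (he : ∀ i j, e i * e j + e j * e i = algebraMap ℝ A (if i = j then -2 else 0))
    (d : ℕ) (b : ℕ → ℝ) : Lap (FF e (d + 2) b) = FF e d (TT n b) := by
  funext x
  have := HasLap.sum (Finset.range (d + 2 + 1))
    (fun k => (b k / ((d + 2 - k).factorial * k.factorial) : ℝ))
    (fun k _ => hasLap_mono e he (d + 2 - k) k x)
  have h := this.eq
  unfold FF at *
  rw [h]
  simp only [smul_add, Finset.sum_add_distrib]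
  rw [Finset.sum_range_succ, Finset.sum_range_succ]
  have hB := Finset.sum_range_succ' (fun k => (b k / ((d + 2 - k).factorial * k.factorial) : ℝ) •
    (kap n k * x 0 ^ (d + 2 - k)) • VV e x ^ (k - 2)) (d + 2)
  rw [Finset.sum_range_succ' _ (d + 1)] at hB
  rw [hB]
  have k0 : kap n 0 = 0 := by simp [kap]
  have k1 : kap n 1 = 0 := by simp [kap]
  have z1 : d + 2 - (d + 1) = 1 := by omega
  simp only [k0, k1, z1, Nat.sub_self, zero_add, zero_mul, zero_smul, smul_zero, add_zero,
    Nat.cast_one, Nat.cast_zero, sub_self, mul_zero]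
  rw [← Finset.sum_add_distrib]
  refine Finset.sum_congr rfl fun k hk => ?_
  have hk' : k ≤ d := by simpa [Nat.lt_succ_iff] using hk
  obtain ⟨r, rfl⟩ := Nat.exists_eq_add_of_le hk'
  have e1 : k + r + 2 - k = r + 2 := by omega
  have e2 : k + r + 2 - (k + 1 + 1) = r := by omega
  have e3 : k + r - k = r := by omega
  have e4 : k + 1 + 1 - 2 = k := by omega
  simp only [e1, e2, e3, e4, Nat.add_sub_cancel, smul_smul, ← add_smul]
  congr 1
  rw [show k + 1 + 1 = k + 2 from rfl, kap_sg, TT]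
  have f1 : (r.factorial : ℝ) ≠ 0 := by positivity
  have f2 : (k.factorial : ℝ) ≠ 0 := by positivity
  have f3 := (sg_pos k).ne'
  have h1 : (k + 1 : ℝ) ≠ 0 := by positivity
  have h2 : (k + 1 + 1 : ℝ) ≠ 0 := by positivity
  have h3 : (r + 1 : ℝ) ≠ 0 := by positivity
  have h4 : (r + 1 + 1 : ℝ) ≠ 0 := by positivity
  simp only [Nat.factorial_succ]
  push_cast
  field_simp
  ring

lemma Lap_iter_FF {n : ℕ} (e : Fin n → A)
    (he : ∀ i j, e i * e j + e j * e i = algebraMap ℝ A (if i = j then -2 else 0))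
    (t : ℕ) : ∀ (d : ℕ) (b : ℕ → ℝ),
    Lap^[t] (FF e (d + 2 * t) b) = FF e d ((TT n)^[t] b) := by
  induction t with
  | zero => intro d b; rfl
  | succ t ih =>
    intro d b
    rw [Function.iterate_succ_apply, Function.iterate_succ_apply,
      show d + 2 * (t + 1) = (d + 2 * t) + 2 by ring, Lap_FF e he, ih]

/-- product -/
noncomputable def PP (n t : ℕ) (s : ℝ) : ℝ := ∏ i ∈ Finset.range t, (2 * i + 1 - n) / (s + 2 * i)

lemma PP_shift (n t : ℕ) (s : ℝ) (hs : 0 < s) : PP n t (s + 2) * (s + 2 * t) = PP n t s * s := by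
  induction t with
  | zero => simp [PP]
  | succ t ih =>
    unfold PP at *
    rw [Finset.prod_range_succ, Finset.prod_range_succ]
    have h1 : s + 2 * (t : ℝ) ≠ 0 := by positivity
    have h2 : s + 2 + 2 * (t : ℝ) ≠ 0 := by positivity
    have h3 := eq_div_of_mul_eq h1 ih
    rw [h3]
    push_cast
    field_simp
    ring

lemma TT_iter (n t : ℕ) (C : ℝ) : (TT n)^[t] (fun _ => C) = fun k => C * PP n t (sg k) := by
  induction t with
  | zero => simp [PP]
  | succ t ih =>
    rw [Function.iterate_succ_apply', ih]
    funext k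
    unfold TT
    have hs := sg_pos k
    have h1 : sg k + 2 * (t : ℝ) ≠ 0 := by positivity
    have h3 := eq_div_of_mul_eq h1 (PP_shift n t (sg k) hs)
    simp only [sg_add, h3]
    have : PP n (t + 1) (sg k) = PP n t (sg k) * ((2 * t + 1 - n) / (sg k + 2 * t)) := by
      unfold PP; rw [Finset.prod_range_succ]
    rw [this]
    field_simp
    ring

lemma prod_odd (m : ℕ) :
    (∏ i ∈ Finset.range m, (1 + 2 * (i : ℝ))) * (2 ^ m * m.factorial) = (2 * m).factorial := by
  induction m with
  | zero => simp
  | succ m ih =>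
    rw [Finset.prod_range_succ, show 2 * (m + 1) = 2 * m + 1 + 1 by ring]
    simp only [Nat.factorial_succ]
    push_cast
    rw [← ih]
    ring

lemma prod_num (m : ℕ) :
    (∏ i ∈ Finset.range m, (2 * (i : ℝ) - 2 * m)) = (-1) ^ m * (2 ^ m * m.factorial) := by
  have h : ∀ i ∈ Finset.range m, (2 * (i : ℝ) - 2 * m) = -2 * ((m - 1 - i : ℕ) + 1 : ℝ) := by
    intro i hi
    have hi' : i < m := by simpa using hi
    have : ((m - 1 - i : ℕ) + 1 : ℝ) = m - i := by
      rw [eq_sub_iff_add_eq]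
      exact_mod_cast (by omega : m - 1 - i + 1 + i = m)
    rw [this]; ring
  rw [Finset.prod_congr rfl h, Finset.prod_mul_distrib,
    Finset.prod_range_reflect (fun i : ℕ => (i + 1 : ℝ)) m, ← Finset.prod_range_add_one_eq_factorial]
  simp only [Finset.prod_const, Finset.card_range]
  push_cast
  rw [← mul_assoc, ← mul_pow]
  norm_num

end helpers

/-- For `n` odd, the monogenic polynomial `P_{n-1,n}(x) = Δ^((n-1)/2) x^(n-1)`, where
`x = x₀ + x₁e₁ + ⋯ + xₙeₙ` is a paravector in the Clifford algebra `ℝₙ` (here realized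
as any normed `ℝ`-algebra `A` with generators `e i` satisfying `eᵢeⱼ + eⱼeᵢ = -2δᵢⱼ`),
is identically equal to the constant `γₙ`. -/
theorem monogenic_polynomial_eq_gammaN (n : ℕ) (hn : Odd n)
    {A : Type*} [NormedRing A] [NormedAlgebra ℝ A] (e : Fin n → A)
    (he : ∀ i j, e i * e j + e j * e i = algebraMap ℝ A (if i = j then -2 else 0))
    (x : Fin (n + 1) → ℝ) :
    (Lap^[(n - 1) / 2]
        (fun c : Fin (n + 1) → ℝ =>
          (algebraMap ℝ A (c 0) + ∑ i : Fin n, c i.succ • e i) ^ (n - 1))) x =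
      algebraMap ℝ A (gammaN n) := by
  obtain ⟨m, rfl⟩ := hn
  have hm : (2 * m + 1 - 1) / 2 = m := by omega
  rw [gammaN, hm, Nat.add_sub_cancel]
  have hF : (fun c : Fin (2 * m + 1 + 1) → ℝ =>
          (algebraMap ℝ A (c 0) + ∑ i : Fin (2 * m + 1), c i.succ • e i) ^ (2 * m))
      = FF e (0 + 2 * m) (fun _ => ((2 * m).factorial : ℝ)) := by
    funext c
    rw [zero_add]
    change (algebraMap ℝ A (c 0) + VV e c) ^ (2 * m) = _
    rw [add_comm, (Algebra.commute_algebraMap_right (c 0) (VV e c)).add_pow]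
    unfold FF
    refine Finset.sum_congr rfl fun k hk => ?_
    have hk' : k ≤ 2 * m := by simpa [Nat.lt_succ_iff] using hk
    have hc : ((2 * m).factorial : ℝ) / ((2 * m - k).factorial * k.factorial)
        = (2 * m).choose k := by
      rw [Nat.cast_choose ℝ hk', mul_comm ((2 * m - k).factorial : ℝ)]
    rw [hc, ← map_pow, smul_smul, mul_smul, ← Algebra.commutes, ← Algebra.smul_def,
      ← Nat.cast_comm, ← nsmul_eq_mul, Nat.cast_smul_eq_nsmul]
  rw [hF, Lap_iter_FF e he, TT_iter]
  have h0 : sg 0 = 1 := by simp [sg]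
  simp only [FF, zero_add, Finset.sum_range_one, h0, Nat.sub_self, pow_zero, Nat.factorial_zero,
    Nat.cast_one, mul_one, div_one, one_smul]
  rw [← Algebra.algebraMap_eq_smul_one]
  congr 1
  have hP : PP (2 * m + 1) m 1 = (∏ i ∈ Finset.range m, (2 * (i : ℝ) - 2 * m)) /
      ∏ i ∈ Finset.range m, (1 + 2 * (i : ℝ)) := by
    unfold PP
    rw [← Finset.prod_div_distrib]
    refine Finset.prod_congr rfl fun i _ => ?_
    push_cast
    ring
  have hne : (∏ i ∈ Finset.range m, (1 + 2 * (i : ℝ))) ≠ 0 :=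
    Finset.prod_ne_zero_iff.mpr fun i _ => by positivity
  rw [hP, prod_num, ← prod_odd, pow_mul']
  field_simp
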